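/- Let μ be a finite signed Borel measure on X×Y with ∫b d|μ| < ∞ and ∫b'_a d|μ| < ∞ for every a ∈ (0,∞). Then the map H → ℝ, f ↦ ∫ L_f dμ, is Fréchet-differentiable, and its Fréchet derivative at f ∈ H is the continuous linear functional H → ℝ, h ↦ ⟨ ∫ L'_f Φ dμ , h ⟩_H. -/

import Mathlib

open MeasureTheory Filter Classical
open scoped ENNReal Topology RealInnerProductSpace

/-- The Bochner integral of a vector-valued function with respect to a finite signed
measure `μ`, defined as `∫ f dμ⁺ - ∫ f dμ⁻` via the Jordan decomposition of `μ`. -/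
noncomputable def sintegral {α : Type*} [MeasurableSpace α] {E : Type*}
    [NormedAddCommGroup E] [NormedSpace ℝ E] (μ : SignedMeasure α) (f : α → E) : E :=
  (∫ a, f a ∂μ.toJordanDecomposition.posPart) - ∫ a, f a ∂μ.toJordanDecomposition.negPart

theorem svm_aux_null {α : Type*} [MeasurableSpace α] (μ : SignedMeasure α) (S : Set α)
    (hS : MeasurableSet S)
    (hsupp : ∀ A : Set α, MeasurableSet A → A ⊆ Sᶜ → μ A = 0) :
    μ.toJordanDecomposition.posPart Sᶜ = 0 ∧ μ.toJordanDecomposition.negPart Sᶜ = 0 := by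
  obtain ⟨i, hi, h1, h2, h3, h4⟩ := μ.toJordanDecomposition_spec
  rw [h3, h4, SignedMeasure.toMeasureOfZeroLE_apply _ _ hi hS.compl,
    SignedMeasure.toMeasureOfLEZero_apply _ _ hi.compl hS.compl]
  have e1 := hsupp (i ∩ Sᶜ) (hi.inter hS.compl) Set.inter_subset_right
  have e2 := hsupp (iᶜ ∩ Sᶜ) (hi.compl.inter hS.compl) Set.inter_subset_right
  constructor
  · rw [ENNReal.coe_eq_zero]; ext; simpa using e1
  · rw [ENNReal.coe_eq_zero]; ext; simpa using e2

theorem svm_aux_pos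
    (d : ℕ) (X : Set (EuclideanSpace ℝ (Fin d))) (hX : MeasurableSet X)
    (Y : Set ℝ) (hY : IsClosed Y)
    (H : Type) [NormedAddCommGroup H] [InnerProductSpace ℝ H] [CompleteSpace H]
    (Φ : EuclideanSpace ℝ (Fin d) → H)
    (hΦcont : ContinuousOn Φ X)
    (κ : ℝ) (hΦbdd : ∀ x ∈ X, ‖Φ x‖ ≤ κ)
    (L L' L'' : EuclideanSpace ℝ (Fin d) → ℝ → ℝ → ℝ)
    (hLmeas : Measurable (fun q : (EuclideanSpace ℝ (Fin d) × ℝ) × ℝ => L q.1.1 q.1.2 q.2))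
    (hL' : ∀ x ∈ X, ∀ y ∈ Y, ∀ t : ℝ, HasDerivAt (L x y) (L' x y t) t)
    (hL'cont : ContinuousOn (fun q : (EuclideanSpace ℝ (Fin d) × ℝ) × ℝ => L' q.1.1 q.1.2 q.2)
      ((X ×ˢ Y) ×ˢ (Set.univ : Set ℝ)))
    (ν : Measure (EuclideanSpace ℝ (Fin d) × ℝ)) [IsFiniteMeasure ν]
    (hν : ν (X ×ˢ Y)ᶜ = 0)
    (p : ℝ) (hp : 1 ≤ p)
    (b : EuclideanSpace ℝ (Fin d) × ℝ → ℝ)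
    (hbint : Integrable b ν)
    (hNemitski : ∀ x ∈ X, ∀ y ∈ Y, ∀ t : ℝ, |L x y t| ≤ b (x, y) + |t| ^ p)
    (henv : ∀ a : ℝ, 0 < a → ∃ b' : EuclideanSpace ℝ (Fin d) × ℝ → ℝ, ∃ b'' : ℝ,
      Integrable b' ν ∧ 0 ≤ b'' ∧
      ∀ x ∈ X, ∀ y ∈ Y, ∀ t ∈ Set.Icc (-a) a, |L' x y t| ≤ b' (x, y) ∧ |L'' x y t| ≤ b'')
    (f : H) :
    HasFDerivAt (fun f' : H =>
        ∫ z : EuclideanSpace ℝ (Fin d) × ℝ, L z.1 z.2 ⟪Φ z.1, f'⟫ ∂ν)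
      (innerSL ℝ (∫ z : EuclideanSpace ℝ (Fin d) × ℝ, L' z.1 z.2 ⟪Φ z.1, f⟫ • Φ z.1 ∂ν)) f := by
  have hS : MeasurableSet (X ×ˢ Y) := hX.prod hY.measurableSet
  have hae : ∀ᵐ z ∂ν, z ∈ X ×ˢ Y := by
    rw [ae_iff]; exact hν
  have hres : ν.restrict (X ×ˢ Y) = ν := Measure.restrict_eq_self_of_ae_mem hae
  have hΦ2 : ContinuousOn (fun z : EuclideanSpace ℝ (Fin d) × ℝ => Φ z.1) (X ×ˢ Y) :=
    hΦcont.comp continuousOn_fst (fun z hz => hz.1)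
  have hin : ∀ g : H, ContinuousOn
      (fun z : EuclideanSpace ℝ (Fin d) × ℝ => (⟪Φ z.1, g⟫ : ℝ)) (X ×ˢ Y) :=
    fun g => hΦ2.inner continuousOn_const
  have hL'g : ∀ g : H, ContinuousOn
      (fun z : EuclideanSpace ℝ (Fin d) × ℝ => L' z.1 z.2 ⟪Φ z.1, g⟫) (X ×ˢ Y) := by
    intro g
    exact hL'cont.comp (f := fun z : EuclideanSpace ℝ (Fin d) × ℝ => (z, (⟪Φ z.1, g⟫ : ℝ)))
      (continuousOn_id.prodMk (hin g)) (fun z hz => ⟨hz, Set.mem_univ _⟩)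
  have hLg : ∀ g : H, AEStronglyMeasurable
      (fun z : EuclideanSpace ℝ (Fin d) × ℝ => L z.1 z.2 ⟪Φ z.1, g⟫) ν := by
    intro g
    have h1 : AEMeasurable (fun z : EuclideanSpace ℝ (Fin d) × ℝ => (⟪Φ z.1, g⟫ : ℝ)) ν := by
      have := (hin g).aemeasurable (μ := ν) hS
      rwa [hres] at this
    exact (hLmeas.comp_aemeasurable (aemeasurable_id.prodMk h1)).aestronglyMeasurable
  have hinb : ∀ g : H, ∀ x ∈ X, |(⟪Φ x, g⟫ : ℝ)| ≤ |κ| * ‖g‖ := by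
    intro g x hx
    refine (abs_real_inner_le_norm _ _).trans ?_
    exact mul_le_mul_of_nonneg_right ((hΦbdd x hx).trans (le_abs_self _)) (norm_nonneg _)
  set a : ℝ := |κ| * (‖f‖ + 1) + 1 with ha
  have ha0 : 0 < a := by positivity
  obtain ⟨b', b'', hb'int, -, hb'⟩ := henv a ha0
  have hbound : ∀ g ∈ Metric.ball f 1, ∀ z ∈ X ×ˢ Y, |L' z.1 z.2 ⟪Φ z.1, g⟫| ≤ b' z := by
    intro g hg z hz
    refine (hb' z.1 hz.1 z.2 hz.2 _ ?_).1
    rw [Set.mem_Icc, ← abs_le]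
    refine (hinb g z.1 hz.1).trans ?_
    have : ‖g‖ ≤ ‖f‖ + 1 := by
      have h1 : ‖g - f‖ < 1 := by simpa [dist_eq_norm] using hg
      have h2 := norm_le_norm_add_norm_sub f g
      have h3 := norm_sub_rev f g
      linarith
    have := mul_le_mul_of_nonneg_left this (abs_nonneg κ)
    linarith
  have hΦm : AEStronglyMeasurable (fun z : EuclideanSpace ℝ (Fin d) × ℝ =>
      L' z.1 z.2 ⟪Φ z.1, f⟫ • Φ z.1) ν := by
    have := ((hL'g f).smul hΦ2).aestronglyMeasurable (μ := ν) hS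
    rwa [hres] at this
  have hB : Integrable (fun z => b' z * |κ|) ν := hb'int.mul_const _
  have hnb : ∀ g ∈ Metric.ball f 1, ∀ z ∈ X ×ˢ Y,
      ‖L' z.1 z.2 ⟪Φ z.1, g⟫ • Φ z.1‖ ≤ b' z * |κ| := by
    intro g hg z hz
    rw [norm_smul, Real.norm_eq_abs]
    exact mul_le_mul (hbound g hg z hz) ((hΦbdd _ hz.1).trans (le_abs_self _)) (norm_nonneg _)
      ((abs_nonneg _).trans (hbound g hg z hz))
  have hΦint : Integrable (fun z : EuclideanSpace ℝ (Fin d) × ℝ =>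
      L' z.1 z.2 ⟪Φ z.1, f⟫ • Φ z.1) ν := by
    refine hB.mono' hΦm ?_
    filter_upwards [hae] with z hz
    exact hnb f (Metric.mem_ball_self one_pos) z hz
  have hLint : Integrable (fun z : EuclideanSpace ℝ (Fin d) × ℝ => L z.1 z.2 ⟪Φ z.1, f⟫) ν := by
    refine (hbint.add (integrable_const ((|κ| * ‖f‖) ^ p))).mono' (hLg f) ?_
    filter_upwards [hae] with z hz
    rw [Real.norm_eq_abs]
    refine (hNemitski z.1 hz.1 z.2 hz.2 _).trans ?_
    have := Real.rpow_le_rpow (abs_nonneg _) (hinb f z.1 hz.1) (by linarith : (0:ℝ) ≤ p)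
    simpa using this
  have key := hasFDerivAt_integral_of_dominated_of_fderiv_le (𝕜 := ℝ) (μ := ν)
    (F := fun (g : H) (z : EuclideanSpace ℝ (Fin d) × ℝ) => L z.1 z.2 ⟪Φ z.1, g⟫)
    (F' := fun (g : H) (z : EuclideanSpace ℝ (Fin d) × ℝ) =>
      innerSL ℝ (L' z.1 z.2 ⟪Φ z.1, g⟫ • Φ z.1)) (x₀ := f)
    (bound := fun z => b' z * |κ|)
    (Metric.ball_mem_nhds f one_pos) (Eventually.of_forall hLg) hLint
    ((innerSL ℝ).continuous.comp_aestronglyMeasurable hΦm)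
    (by
      filter_upwards [hae] with z hz g hg
      rw [innerSL_apply_norm]
      exact hnb g hg z hz) hB
    (by
      filter_upwards [hae] with z hz g hg
      have h1 := (hL' z.1 hz.1 z.2 hz.2 ⟪Φ z.1, g⟫).comp_hasFDerivAt g
        (innerSL ℝ (Φ z.1)).hasFDerivAt
      have h2 : innerSL ℝ (L' z.1 z.2 ⟪Φ z.1, g⟫ • Φ z.1)
          = L' z.1 z.2 ⟪Φ z.1, g⟫ • innerSL ℝ (Φ z.1) := by
        ext h
        simp [inner_smul_left]
      rw [h2]
      exact h1)
  have hI : Integrable (fun z : EuclideanSpace ℝ (Fin d) × ℝ =>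
      innerSL ℝ (L' z.1 z.2 ⟪Φ z.1, f⟫ • Φ z.1)) ν := by
    refine hΦint.norm.mono' ((innerSL ℝ).continuous.comp_aestronglyMeasurable hΦm) ?_
    filter_upwards with z
    rw [innerSL_apply_norm]
  suffices hD : innerSL ℝ (∫ z : EuclideanSpace ℝ (Fin d) × ℝ,
      L' z.1 z.2 ⟪Φ z.1, f⟫ • Φ z.1 ∂ν) = ∫ z : EuclideanSpace ℝ (Fin d) × ℝ,
      innerSL ℝ (L' z.1 z.2 ⟪Φ z.1, f⟫ • Φ z.1) ∂ν by
    rw [hD]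
    exact key
  ext h
  rw [ContinuousLinearMap.integral_apply hI, innerSL_apply_apply, real_inner_comm,
    ← integral_inner hΦint h]
  refine integral_congr_ae (Eventually.of_forall fun z => ?_)
  simp only [innerSL_apply_apply]
  rw [real_inner_comm]

/-- **Fréchet differentiability of the generalized risk** (Lemma 3(a) of the paper).
For a finite signed measure `μ` on `X × Y` with `∫ b d|μ| < ∞` and `∫ b'_a d|μ| < ∞` for
all `a > 0`, the map `f ↦ ∫ L_f dμ` on `H` is Fréchet-differentiable with derivative
`h ↦ ⟨∫ L'_f Φ dμ, h⟩` at `f`. -/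
theorem svm_risk_frechet_differentiable
    (d : ℕ) (X : Set (EuclideanSpace ℝ (Fin d))) [CompactSpace X]
    (Y : Set ℝ) (hY : IsClosed Y)
    -- the separable RKHS `H` of a continuous bounded kernel, via its feature map `Φ`
    (H : Type) [NormedAddCommGroup H] [InnerProductSpace ℝ H] [CompleteSpace H]
    [TopologicalSpace.SeparableSpace H]
    (Φ : EuclideanSpace ℝ (Fin d) → H)
    (hΦcont : ContinuousOn Φ X)
    (κ : ℝ) (hΦbdd : ∀ x ∈ X, ‖Φ x‖ ≤ κ)
    -- the loss function and its partial derivatives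
    (L L' L'' : EuclideanSpace ℝ (Fin d) → ℝ → ℝ → ℝ)
    (hLmeas : Measurable (fun q : (EuclideanSpace ℝ (Fin d) × ℝ) × ℝ => L q.1.1 q.1.2 q.2))
    (hLnonneg : ∀ x ∈ X, ∀ y ∈ Y, ∀ t : ℝ, 0 ≤ L x y t)
    (hL' : ∀ x ∈ X, ∀ y ∈ Y, ∀ t : ℝ, HasDerivAt (L x y) (L' x y t) t)
    (hL'' : ∀ x ∈ X, ∀ y ∈ Y, ∀ t : ℝ, HasDerivAt (L' x y) (L'' x y t) t)
    (hL'cont : ContinuousOn (fun q : (EuclideanSpace ℝ (Fin d) × ℝ) × ℝ => L' q.1.1 q.1.2 q.2)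
      ((X ×ˢ Y) ×ˢ (Set.univ : Set ℝ)))
    (hL''cont : ContinuousOn (fun q : (EuclideanSpace ℝ (Fin d) × ℝ) × ℝ => L'' q.1.1 q.1.2 q.2)
      ((X ×ˢ Y) ×ˢ (Set.univ : Set ℝ)))
    -- the finite signed measure `μ`, concentrated on `X × Y`
    (μ : SignedMeasure (EuclideanSpace ℝ (Fin d) × ℝ))
    (hsupp : ∀ A : Set (EuclideanSpace ℝ (Fin d) × ℝ),
      MeasurableSet A → A ⊆ (X ×ˢ Y)ᶜ → μ A = 0)
    -- `∫ b d|μ| < ∞` for the Nemitski majorant `b` of `L`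
    (p : ℝ) (hp : 1 ≤ p)
    (b : EuclideanSpace ℝ (Fin d) × ℝ → ℝ)
    (hbint : Integrable b μ.totalVariation)
    (hNemitski : ∀ x ∈ X, ∀ y ∈ Y, ∀ t : ℝ, |L x y t| ≤ b (x, y) + |t| ^ p)
    -- `∫ b'_a d|μ| < ∞` for the envelopes of `L'`, with constant envelopes for `L''`
    (henv : ∀ a : ℝ, 0 < a → ∃ b' : EuclideanSpace ℝ (Fin d) × ℝ → ℝ, ∃ b'' : ℝ,
      Integrable b' μ.totalVariation ∧ 0 ≤ b'' ∧
      ∀ x ∈ X, ∀ y ∈ Y, ∀ t ∈ Set.Icc (-a) a, |L' x y t| ≤ b' (x, y) ∧ |L'' x y t| ≤ b'')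
    :
    ∀ f : H, ∃ D : H →L[ℝ] ℝ,
      (∀ h : H, D h = ⟪sintegral μ (fun z : EuclideanSpace ℝ (Fin d) × ℝ =>
          L' z.1 z.2 ⟪Φ z.1, f⟫ • Φ z.1), h⟫) ∧
      HasFDerivAt (fun f' : H =>
        sintegral μ (fun z : EuclideanSpace ℝ (Fin d) × ℝ => L z.1 z.2 ⟪Φ z.1, f'⟫)) D f := by
  intro f
  have hXm : MeasurableSet X := (isCompact_iff_compactSpace.mpr inferInstance).measurableSet
  obtain ⟨h1, h2⟩ := svm_aux_null μ (X ×ˢ Y) (hXm.prod hY.measurableSet) hsupp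
  have hle1 : μ.toJordanDecomposition.posPart ≤ μ.totalVariation :=
    Measure.le_add_right le_rfl
  have hle2 : μ.toJordanDecomposition.negPart ≤ μ.totalVariation :=
    Measure.le_add_left le_rfl
  have A := svm_aux_pos d X hXm Y hY H Φ hΦcont κ hΦbdd L L' L'' hLmeas hL' hL'cont
    μ.toJordanDecomposition.posPart h1 p hp b (hbint.mono_measure hle1) hNemitski
    (fun a ha => by
      obtain ⟨b', b'', h, h'⟩ := henv a ha
      exact ⟨b', b'', h.mono_measure hle1, h'⟩) f
  have B := svm_aux_pos d X hXm Y hY H Φ hΦcont κ hΦbdd L L' L'' hLmeas hL' hL'cont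
    μ.toJordanDecomposition.negPart h2 p hp b (hbint.mono_measure hle2) hNemitski
    (fun a ha => by
      obtain ⟨b', b'', h, h'⟩ := henv a ha
      exact ⟨b', b'', h.mono_measure hle2, h'⟩) f
  refine ⟨_, ?_, A.sub B⟩
  intro h
  simp [sintegral, inner_sub_left]
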